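/- Let d ≥ 1 and n ≥ 0 be natural numbers. There exists a nonzero polynomial Q ∈ MvPolynomial (Fin d × Fin (n+1)) ℂ such that for every tuple of linear-form coefficients L : Fin d → (Fin (n+1) → ℂ) at which Q evaluates to a nonzero value, the ℂ-linear span of the set { X i · ∏_{α : Fin d, α ≠ k} ℓ_{L α} : k ∈ Fin d, i ∈ Fin (n+1) } in MvPolynomial (Fin (n+1)) ℂ has dimension (finrank) equal to d·n + 1. (This expresses that the affine cone over the Chow variety C_{d,n} has dimension d·n + 1, its tangent space at a generic smooth point p = L_0⋯L_{d−1} being spanned by the listed products.) -/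

import Mathlib

/-- The linear form `ℓ_a = ∑ i, a i • X i` in `n+1` variables. -/
noncomputable def linForm (n : ℕ) (a : Fin (n + 1) → ℂ) : MvPolynomial (Fin (n + 1)) ℂ :=
  ∑ i, a i • MvPolynomial.X i

section

open MvPolynomial

/-- The map `a ↦ ℓ_a` as a linear map. -/
noncomputable def linFormMap (n : ℕ) : (Fin (n + 1) → ℂ) →ₗ[ℂ] MvPolynomial (Fin (n + 1)) ℂ :=
  Fintype.linearCombination ℂ X

lemma linFormMap_apply (n : ℕ) (a : Fin (n + 1) → ℂ) : linFormMap n a = linForm n a := rfl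

lemma linForm_eq_sumSMulX (n : ℕ) (a : Fin (n + 1) → ℂ) :
    linForm n a = sumSMulX (Finsupp.equivFunOnFinite.symm a) := by
  simp [linForm, sumSMulX, Finsupp.linearCombination_apply, Finsupp.sum_fintype]

lemma coeff_linForm (n : ℕ) (a : Fin (n + 1) → ℂ) (i : Fin (n + 1)) :
    (linForm n a).coeff (Finsupp.single i 1) = a i := by
  rw [linForm_eq_sumSMulX, coeff_sumSMulX]
  rfl

lemma linForm_injective (n : ℕ) : Function.Injective (linForm n) := fun a b h => by
  ext i
  rw [← coeff_linForm n a i, h, coeff_linForm]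

lemma linForm_smul (n : ℕ) (c : ℂ) (a : Fin (n + 1) → ℂ) :
    linForm n (c • a) = c • linForm n a :=
  (linFormMap n).map_smul c a

lemma linForm_eq_zero {n : ℕ} {a : Fin (n + 1) → ℂ} : linForm n a = 0 ↔ a = 0 :=
  map_eq_zero_iff (linFormMap n) (linForm_injective n)

lemma totalDegree_linForm_le (n : ℕ) (a : Fin (n + 1) → ℂ) : (linForm n a).totalDegree ≤ 1 :=
  totalDegree_finsetSum_le fun _ _ => (totalDegree_smul_le _ _).trans (totalDegree_X _).le

lemma irreducible_linForm {n : ℕ} {a : Fin (n + 1) → ℂ} (ha : a ≠ 0) :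
    Irreducible (linForm n a) := by
  obtain ⟨i, hi⟩ := Function.ne_iff.mp ha
  rw [linForm_eq_sumSMulX]
  refine irreducible_sumSMulX _ ⟨i, by simpa using hi⟩ fun r hr => ?_
  refine isUnit_iff_ne_zero.mpr ?_
  rintro rfl
  exact hi (by simpa using hr i)

lemma exists_smul_of_linForm_dvd {n : ℕ} {a b : Fin (n + 1) → ℂ} (ha : a ≠ 0)
    (h : linForm n a ∣ linForm n b) : ∃ c : ℂ, b = c • a := by
  rcases eq_or_ne b 0 with rfl | hb
  · exact ⟨0, by simp⟩
  obtain ⟨q, hq⟩ := h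
  have hb' : linForm n b ≠ 0 := linForm_eq_zero.not.mpr hb
  have ha' : linForm n a ≠ 0 := linForm_eq_zero.not.mpr ha
  have hq' : q ≠ 0 := by
    rintro rfl
    exact hb' (by simpa using hq)
  have hdeg := totalDegree_mul_of_isDomain ha' hq'
  rw [← hq] at hdeg
  have hone : (linForm n a).totalDegree ≠ 0 := fun h0 =>
    (irreducible_linForm ha).not_isUnit <| isUnit_iff_totalDegree_of_isReduced.mpr
      ⟨isUnit_iff_ne_zero.mpr fun hc =>
        ha' ((totalDegree_eq_zero_iff_eq_C.mp h0).trans (by rw [hc, C_0])), h0⟩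
  have hle := totalDegree_linForm_le n b
  have hC := totalDegree_eq_zero_iff_eq_C.mp (show q.totalDegree = 0 by lia)
  refine ⟨q.coeff 0, linForm_injective n ?_⟩
  rw [linForm_smul, hq, smul_eq_C_mul, ← hC, mul_comm]

section Tangent

variable {d n : ℕ} (L : Fin d → Fin (n + 1) → ℂ)

/-- The differential of `(ℓ_k)_k ↦ ∏ k, ℓ_k` at `L`. -/
noncomputable def chowDifferential :
    (Fin d → Fin (n + 1) → ℂ) →ₗ[ℂ] MvPolynomial (Fin (n + 1)) ℂ :=
  ∑ k, LinearMap.mulRight ℂ (∏ α ∈ Finset.univ.filter (fun α => α ≠ k), linForm n (L α)) ∘ₗ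
    linFormMap n ∘ₗ LinearMap.proj k

lemma chowDifferential_apply (v : Fin d → Fin (n + 1) → ℂ) :
    chowDifferential L v = ∑ k, linForm n (v k) *
      ∏ α ∈ Finset.univ.filter (fun α => α ≠ k), linForm n (L α) := by
  simp [chowDifferential, linFormMap_apply]

lemma range_chowDifferential :
    LinearMap.range (chowDifferential L) = Submodule.span ℂ
      {q : MvPolynomial (Fin (n + 1)) ℂ | ∃ k : Fin d, ∃ i : Fin (n + 1),
        q = X i * ∏ α ∈ Finset.univ.filter (fun α : Fin d => α ≠ k), linForm n (L α)} := by
  apply le_antisymm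
  · rintro _ ⟨v, rfl⟩
    rw [chowDifferential_apply]
    refine Submodule.sum_mem _ fun k _ => ?_
    rw [linForm, Finset.sum_mul]
    refine Submodule.sum_mem _ fun i _ => ?_
    rw [smul_mul_assoc]
    exact Submodule.smul_mem _ _ (Submodule.subset_span ⟨k, i, rfl⟩)
  · rw [Submodule.span_le]
    rintro _ ⟨k, i, rfl⟩
    refine ⟨Pi.single k (Pi.single i 1), ?_⟩
    have hX : linForm n (Pi.single i 1) = X i := by
      simp [linForm, Pi.single_apply]
    rw [chowDifferential_apply, Finset.sum_eq_single k]
    · rw [Pi.single_eq_same, hX]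
    · intro l _ hl
      rw [Pi.single_eq_of_ne hl, linForm_eq_zero.mpr rfl, zero_mul]
    · simp

lemma chowDifferential_smul (c : Fin d → ℂ) :
    chowDifferential L (fun k => c k • L k) = (∑ k, c k) • ∏ k, linForm n (L k) := by
  rw [chowDifferential_apply, Finset.sum_smul]
  refine Finset.sum_congr rfl fun k _ => ?_
  rw [linForm_smul, smul_mul_assoc, Finset.filter_ne',
    Finset.mul_prod_erase _ (fun k => linForm n (L k)) (Finset.mem_univ k)]

variable {L}

lemma exists_smul_of_chowDifferential_eq_zero (hL : ∀ k, L k ≠ 0)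
    (hind : ∀ k l, k ≠ l → ¬ ∃ c : ℂ, L l = c • L k)
    {v : Fin d → Fin (n + 1) → ℂ} (hv : chowDifferential L v = 0) (k : Fin d) :
    ∃ c : ℂ, v k = c • L k := by
  have hp : Prime (linForm n (L k)) := (irreducible_linForm (hL k)).prime
  rw [chowDifferential_apply, ← Finset.add_sum_erase _ _ (Finset.mem_univ k)] at hv
  have hdvd : linForm n (L k) ∣ linForm n (v k) *
      ∏ α ∈ Finset.univ.filter (fun α => α ≠ k), linForm n (L α) := by
    rw [eq_neg_of_add_eq_zero_left hv, dvd_neg]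
    refine Finset.dvd_sum fun l hl => Dvd.dvd.mul_left (Finset.dvd_prod_of_mem _ ?_) _
    simpa using (Finset.ne_of_mem_erase hl).symm
  rcases hp.dvd_or_dvd hdvd with h | h
  · exact exists_smul_of_linForm_dvd (hL k) h
  · obtain ⟨l, hl, h⟩ := (hp.dvd_finsetProd_iff _).mp h
    exact absurd (exists_smul_of_linForm_dvd (hL k) h) (hind k l ((Finset.mem_filter.mp hl).2.symm))

lemma finrank_range_chowDifferential (hd : 1 ≤ d) (hL : ∀ k, L k ≠ 0)
    (hker : ∀ v, chowDifferential L v = 0 → ∀ k, ∃ c : ℂ, v k = c • L k) :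
    Module.finrank ℂ (LinearMap.range (chowDifferential L)) = d * n + 1 := by
  let s : Module.Dual ℂ (Fin d → ℂ) := Fintype.linearCombination ℂ (fun _ => (1 : ℂ))
  have hs (c : Fin d → ℂ) : s c = ∑ k, c k := by
    simp [s, Fintype.linearCombination_apply]
  have hs0 : s ≠ 0 := fun h => by
    have h1 := hs (Pi.single ⟨0, hd⟩ 1)
    simp [h] at h1
  let ψ : (Fin d → ℂ) →ₗ[ℂ] (Fin d → Fin (n + 1) → ℂ) :=
    LinearMap.pi fun k => (LinearMap.toSpanSingleton ℂ _ (L k)) ∘ₗ LinearMap.proj k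
  have hψ (c : Fin d → ℂ) : ψ c = fun k => c k • L k := rfl
  have hψi : Function.Injective ψ := fun c c' h => by
    ext k
    exact smul_left_injective ℂ (hL k) (congrFun h k)
  have hP : ∏ k, linForm n (L k) ≠ 0 :=
    Finset.prod_ne_zero_iff.mpr fun k _ => linForm_eq_zero.not.mpr (hL k)
  have hK : LinearMap.ker (chowDifferential L) = (LinearMap.ker s).map ψ := by
    ext v
    simp only [LinearMap.mem_ker, Submodule.mem_map]
    constructor
    · intro hv
      choose c hc using hker v hv
      obtain rfl : v = fun k => c k • L k := funext hc
      rw [chowDifferential_smul] at hv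
      exact ⟨c, (hs c).trans ((smul_eq_zero.mp hv).resolve_right hP), rfl⟩
    · rintro ⟨c, hc, rfl⟩
      rw [hψ, chowDifferential_smul, ← hs, hc, zero_smul]
  have h1 := LinearMap.finrank_range_add_finrank_ker (chowDifferential L)
  have h2 := Module.Dual.finrank_ker_add_one_of_ne_zero hs0
  rw [hK, ← (Submodule.equivMapOfInjective ψ hψi _).finrank_eq] at h1
  simp only [Module.finrank_pi_fintype, Module.finrank_self, Finset.sum_const, Finset.card_univ,
    Fintype.card_fin, smul_eq_mul, mul_add, mul_one] at h1 h2
  lia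

/-- In one variable every linear form is a multiple of any nonzero one. -/
lemma exists_smul_eq_of_fin_one {a : Fin (0 + 1) → ℂ} (ha : a ≠ 0) (b : Fin (0 + 1) → ℂ) :
    ∃ c : ℂ, b = c • a := by
  obtain ⟨i, hi⟩ := Function.ne_iff.mp ha
  refine ⟨b i / a i, ?_⟩
  ext j
  rw [Subsingleton.elim (α := Fin 1) j i, Pi.smul_apply, smul_eq_mul, div_mul_cancel₀ _ hi]

end Tangent

/-- The tuples `L` whose members all have nonzero `0`-th coordinate and, if `n ≠ 0`, are pairwise
separated by the minor of the `0`-th and last coordinates, form the nonvanishing locus of this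
polynomial. -/
noncomputable def genericityPolynomial (d n : ℕ) : MvPolynomial (Fin d × Fin (n + 1)) ℂ :=
  (∏ k, X (k, 0)) * if n = 0 then 1 else ∏ p ∈ Finset.univ.offDiag,
    (X (p.1, 0) * X (p.2, Fin.last n) - X (p.1, Fin.last n) * X (p.2, 0))

lemma genericityPolynomial_ne_zero (d n : ℕ) : genericityPolynomial d n ≠ 0 := by
  intro h
  have h := congrArg (eval fun x : Fin d × Fin (n + 1) => if x.2 = 0 then (1 : ℂ) else x.1) h
  rw [genericityPolynomial, map_mul, map_zero] at h
  split_ifs at h with hn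
  · simp at h
  · have hlast : Fin.last n ≠ 0 := fun h => hn (congrArg Fin.val h)
    simp [hlast, Finset.prod_eq_zero_iff, sub_eq_zero, Fin.val_inj] at h

lemma ne_zero_of_eval_genericityPolynomial {d n : ℕ} {L : Fin d → Fin (n + 1) → ℂ}
    (h : eval (fun x => L x.1 x.2) (genericityPolynomial d n) ≠ 0) (k : Fin d) : L k ≠ 0 := by
  rw [genericityPolynomial, map_mul, map_prod] at h
  have h0 := Finset.prod_ne_zero_iff.mp (left_ne_zero_of_mul h) k (Finset.mem_univ k)
  rw [eval_X] at h0
  exact fun hk => h0 (congrFun hk 0)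

lemma not_exists_smul_of_eval_genericityPolynomial {d n : ℕ} (hn : n ≠ 0)
    {L : Fin d → Fin (n + 1) → ℂ}
    (h : eval (fun x => L x.1 x.2) (genericityPolynomial d n) ≠ 0) {k l : Fin d} (hkl : k ≠ l) :
    ¬ ∃ c : ℂ, L l = c • L k := by
  rintro ⟨c, hc⟩
  rw [genericityPolynomial, if_neg hn, map_mul, map_prod, map_prod] at h
  have h0 := Finset.prod_ne_zero_iff.mp (right_ne_zero_of_mul h) (k, l) (by simpa using hkl)
  simp only [map_sub, map_mul, eval_X, hc, Pi.smul_apply, smul_eq_mul] at h0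
  exact h0 (by ring)

end

/-- The affine cone over the Chow variety `C_{d,n}` has dimension `d·n + 1`: at a generic
point `p = L_0 ⋯ L_{d-1}` the span of the tangent vectors `x_i · ∏_{α ≠ k} L_α` has
dimension `d·n + 1`. -/
theorem chow_cone_dim (d n : ℕ) (hd : 1 ≤ d) :
    ∃ Q : MvPolynomial (Fin d × Fin (n + 1)) ℂ, Q ≠ 0 ∧
      ∀ L : Fin d → (Fin (n + 1) → ℂ),
        MvPolynomial.eval (fun x => L x.1 x.2) Q ≠ 0 →
        Module.finrank ℂ (Submodule.span ℂ
          {q : MvPolynomial (Fin (n + 1)) ℂ | ∃ k : Fin d, ∃ i : Fin (n + 1),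
            q = MvPolynomial.X i *
              ∏ α ∈ Finset.univ.filter (fun α : Fin d => α ≠ k), linForm n (L α)})
          = d * n + 1 := by
  refine ⟨genericityPolynomial d n, genericityPolynomial_ne_zero d n, fun L h => ?_⟩
  have hL := ne_zero_of_eval_genericityPolynomial h
  rw [← range_chowDifferential]
  refine finrank_range_chowDifferential hd hL fun v hv k => ?_
  rcases eq_or_ne n 0 with rfl | hn
  · exact exists_smul_eq_of_fin_one (hL k) (v k)
  · exact exists_smul_of_chowDifferential_eq_zero hL
      (fun _ _ => not_exists_smul_of_eval_genericityPolynomial hn h) hv k
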